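/- For every Coxeter group W, the two-sided ideal J(W) of Ĥ(W) generated by K(W) ∩ ker ε is a Hopf ideal: Δ(J(W)) ⊆ Ĥ(W) ⊗ J(W) + J(W) ⊗ Ĥ(W), ε(J(W)) = 0, and S(J(W)) ⊆ J(W); consequently the quotient algebra H̲(W) = Ĥ(W)/J(W) inherits a Hopf algebra structure over ℤ. -/

import Mathlib

open scoped TensorProduct

namespace HeckeHopfCox

/-- Generators of `Ĥ(W)`: `s i` and `D i` for `i ∈ I`. -/
inductive Gen (B : Type*) : Type _
  | s : B → Gen B
  | D : B → Gen B

/-- The free `ℤ`-algebra on the generators. -/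
abbrev F (B : Type*) : Type _ := FreeAlgebra ℤ (Gen B)

noncomputable def fs {B : Type*} (i : B) : F B := FreeAlgebra.ι ℤ (Gen.s i)
noncomputable def fD {B : Type*} (i : B) : F B := FreeAlgebra.ι ℤ (Gen.D i)

/-- The alternating word `sᵢ sⱼ sᵢ ⋯` with `k` factors, starting with `sᵢ`. -/
noncomputable def altS {B : Type*} (i j : B) : ℕ → F B
  | 0 => 1
  | k + 1 => fs i * altS j i k

/-- The defining relations of `Ĥ(W)`: (i) rank-one relations; (ii) Coxeter relations;
(iii) the linear braid relations `Dᵢ·(sⱼsᵢ⋯s_{j'}) = (sⱼ⋯s_{i'}s_{j'})·D_{i'}`, where the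
alternating word has `m_{ij} - 1` factors starting with `sⱼ`, and `i' = i` if `m_{ij}` is
even and `i' = j` if `m_{ij}` is odd. -/
inductive Rel {B : Type*} (M : CoxeterMatrix B) : F B → F B → Prop
  | s_sq (i : B) : Rel M (fs i * fs i) 1
  | D_sq (i : B) : Rel M (fD i * fD i) (fD i)
  | sD (i : B) : Rel M (fs i * fD i + fD i * fs i) (fs i - 1)
  | coxeter (i j : B) : Rel M ((fs i * fs j) ^ M i j) 1
  | braidLin (i j : B) : i ≠ j → M i j ≠ 0 →
      Rel M (fD i * altS j i (M i j - 1))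
        (altS j i (M i j - 1) * fD (if M i j % 2 = 0 then i else j))

/-- The algebra `Ĥ(W)` associated to a Coxeter matrix. -/
abbrev HW {B : Type*} (M : CoxeterMatrix B) : Type _ := RingQuot (Rel M)

/-- The image of the generator `sᵢ` in `Ĥ(W)`. -/
noncomputable def hs {B : Type*} (M : CoxeterMatrix B) (i : B) : HW M :=
  RingQuot.mkAlgHom ℤ (Rel M) (fs i)

/-- The image of the generator `Dᵢ` in `Ĥ(W)`. -/
noncomputable def hD {B : Type*} (M : CoxeterMatrix B) (i : B) : HW M :=
  RingQuot.mkAlgHom ℤ (Rel M) (fD i)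

/-- The set of reflections of the Coxeter group `W`, as a subtype. -/
abbrev Refl {B : Type*} (M : CoxeterMatrix B) : Type _ :=
  {t : M.Group // M.toCoxeterSystem.IsReflection t}

/-- A Hopf algebra structure on an `R`-algebra `A`: an algebra-homomorphism
comultiplication and counit and an anti-homomorphism antipode, satisfying the
coassociativity, counit and antipode axioms. -/
structure HopfAlgStruct (R : Type*) (A : Type*) [CommRing R] [Ring A] [Algebra R A] where
  comul : A →ₐ[R] A ⊗[R] A
  counit : A →ₐ[R] R
  antipode : A →ₗ[R] A
  antipode_one : antipode 1 = 1
  antipode_mul : ∀ x y : A, antipode (x * y) = antipode y * antipode x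
  coassoc : ∀ x : A,
    (TensorProduct.assoc R A A A) ((Algebra.TensorProduct.map comul (AlgHom.id R A)) (comul x)) =
      (Algebra.TensorProduct.map (AlgHom.id R A) comul) (comul x)
  counit_comul : ∀ x : A,
    (TensorProduct.lid R A) ((LinearMap.rTensor A counit.toLinearMap) (comul x)) = x
  comul_counit : ∀ x : A,
    (TensorProduct.rid R A) ((LinearMap.lTensor A counit.toLinearMap) (comul x)) = x
  mul_antipode_rTensor_comul : ∀ x : A,
    (LinearMap.mul' R A) ((LinearMap.rTensor A antipode) (comul x)) = algebraMap R A (counit x)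
  mul_antipode_lTensor_comul : ∀ x : A,
    (LinearMap.mul' R A) ((LinearMap.lTensor A antipode) (comul x)) = algebraMap R A (counit x)

/-- `K(W) = ⋂_w π(w)·D̂(W)·π(w)⁻¹`, where `D̂(W)` is the subalgebra generated by the
family `(D_s)_{s ∈ 𝒮}`. -/
def KW {B : Type*} (M : CoxeterMatrix B) (π : M.Group →* (HW M)ˣ)
    (Dfam : Refl M → HW M) : Set (HW M) :=
  {x | ∀ w : M.Group,
    ((π w : (HW M)ˣ) : HW M) * x * (((π w)⁻¹ : (HW M)ˣ) : HW M) ∈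
      Algebra.adjoin ℤ (Set.range Dfam)}

/-- The two-sided ideal `J(W)` generated by `K(W) ∩ ker ε`, as a `ℤ`-submodule. -/
def JW {B : Type*} (M : CoxeterMatrix B) (π : M.Group →* (HW M)ˣ)
    (Dfam : Refl M → HW M) (ε : HW M →ₐ[ℤ] ℤ) : Submodule ℤ (HW M) :=
  Submodule.span ℤ
    {y | ∃ a k b : HW M, k ∈ KW M π Dfam ∧ ε k = 0 ∧ y = a * k * b}

/-- The relation presenting the quotient of `Ĥ(W)` by the two-sided ideal generated by
`K(W) ∩ ker ε`; its `RingQuot` is the lower Hecke-Hopf algebra `H̲(W)`. -/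
def lowRel {B : Type*} (M : CoxeterMatrix B) (π : M.Group →* (HW M)ˣ)
    (Dfam : Refl M → HW M) (ε : HW M →ₐ[ℤ] ℤ) : HW M → HW M → Prop :=
  fun x y => x ∈ KW M π Dfam ∧ ε x = 0 ∧ y = 0

section Geometric

open Polynomial.Chebyshev Module

lemma eval_S_two_mul_cos (θ : ℝ) (n : ℤ) :
    (S ℝ n).eval (2 * Real.cos θ) * Real.sin θ = Real.sin ((n + 1) * θ) := by
  rw [← U_real_cos, ← S_comp_two_mul_X]
  simp

lemma sin_two_pi_div_pos {m : ℕ} (hm : 3 ≤ m) : 0 < Real.sin (2 * Real.pi / m) := by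
  have hm' : (3 : ℝ) ≤ m := by exact_mod_cast hm
  have hpi := Real.pi_pos
  apply Real.sin_pos_of_pos_of_lt_pi (by positivity)
  rw [div_lt_iff₀ (by linarith)]
  nlinarith

lemma four_mul_cos_sq_sub_two (m : ℕ) :
    4 * Real.cos (Real.pi / m) ^ 2 - 2 = 2 * Real.cos (2 * Real.pi / m) := by
  rw [mul_div_assoc, Real.cos_two_mul]
  ring

/-- Two reflections whose product is a rotation by the angle `2π/m` satisfy the braid relation. -/
lemma reflection_mul_reflection_pow_eq_one {V : Type*} [AddCommGroup V] [Module ℝ V] {x y : V}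
    {f g : Dual ℝ V} (hf : f x = 2) (hg : g y = 2) {m : ℕ} (hm : 3 ≤ m)
    (hfg : f y * g x = 4 * Real.cos (Real.pi / m) ^ 2) :
    (reflection hf * reflection hg) ^ m = 1 := by
  have hsin := (sin_two_pi_div_pos hm).ne'
  have hm0 : (m : ℝ) ≠ 0 := by positivity
  ext z
  rw [reflection_mul_reflection_pow_apply hf hg m z (2 * Real.cos (2 * Real.pi / m))
    (by rw [hfg, four_mul_cos_sq_sub_two])]
  obtain ⟨p, rfl | rfl⟩ := m.even_or_odd'
  · have h1 : (((2 * p : ℕ) : ℤ) - 2) / 2 = p - 1 := by omega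
    have h2 : (((2 * p : ℕ) : ℤ) - 1) / 2 = p - 1 := by omega
    have h0 : (S ℝ ((p : ℤ) - 1)).eval (2 * Real.cos (2 * Real.pi / (2 * p : ℕ))) = 0 := by
      apply (mul_eq_zero.1 _).resolve_right hsin
      rw [eval_S_two_mul_cos]
      rw [show (((p - 1 : ℤ) : ℝ) + 1) * (2 * Real.pi / (2 * p : ℕ)) = Real.pi by
        have hp : (p : ℝ) ≠ 0 := by
          rintro h
          simp [h] at hm0
        push_cast
        field_simp
        ring, Real.sin_pi]
    simp only [h1, h2, h0, zero_mul, zero_smul, add_zero]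
    rfl
  · have h1 : (((2 * p + 1 : ℕ) : ℤ) - 2) / 2 = p - 1 := by omega
    have h2 : (((2 * p + 1 : ℕ) : ℤ) - 1) / 2 = p := by omega
    have h3 : (((2 * p + 1 : ℕ) : ℤ) - 3) / 2 = p - 1 := by omega
    have h4 : (((2 * p + 1 : ℕ) : ℤ)) / 2 = p := by omega
    have h0 : (S ℝ (p : ℤ)).eval (2 * Real.cos (2 * Real.pi / (2 * p + 1 : ℕ))) +
        (S ℝ ((p : ℤ) - 1)).eval (2 * Real.cos (2 * Real.pi / (2 * p + 1 : ℕ))) = 0 := by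
      apply (mul_eq_zero.1 _).resolve_right hsin
      rw [add_mul, eval_S_two_mul_cos, eval_S_two_mul_cos]
      rw [show ((p : ℤ) + 1 : ℝ) * (2 * Real.pi / (2 * p + 1 : ℕ)) =
          2 * Real.pi - (((p - 1 : ℤ) : ℝ) + 1) * (2 * Real.pi / (2 * p + 1 : ℕ)) by
        push_cast at hm0 ⊢
        field_simp
        ring, Real.sin_two_pi_sub, neg_add_cancel]
    simp only [h1, h2, h3, h4, h0, mul_zero, zero_smul, add_zero]
    rfl

/-- Before the `m`-th power, a rotation by `2π/m` moves the root it is applied to. -/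
lemma reflection_mul_reflection_pow_apply_self_ne {V : Type*} [AddCommGroup V] [Module ℝ V]
    {x y : V} {f g : Dual ℝ V} (hf : f x = 2) (hg : g y = 2) (hxy : LinearIndependent ℝ ![x, y])
    {m : ℕ} (hm : 3 ≤ m) (hfg : f y * g x = 4 * Real.cos (Real.pi / m) ^ 2) (hgx : g x ≠ 0)
    {l : ℕ} (hl : 0 < l) (hlm : l < m) :
    ((reflection hf * reflection hg) ^ l) x ≠ x := by
  have hsin := (sin_two_pi_div_pos hm).ne'
  have hm0 : (m : ℝ) ≠ 0 := by positivity
  have hpi := Real.pi_pos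
  intro h
  rw [reflection_mul_reflection_pow_apply_self hf hg l (2 * Real.cos (2 * Real.pi / m))
    (by rw [hfg, four_mul_cos_sq_sub_two])] at h
  have hpair := LinearIndependent.pair_iff.1 hxy
  generalize hS : (S ℝ (l : ℤ)).eval (2 * Real.cos (2 * Real.pi / m)) = a at h
  generalize hS' : (S ℝ ((l : ℤ) - 1)).eval (2 * Real.cos (2 * Real.pi / m)) = b at h
  obtain ⟨ha, hb⟩ := hpair (a + b - 1) (b * -g x)
    (by rw [sub_smul, one_smul, sub_add_eq_add_sub, h, sub_self])
  have hb' := (mul_eq_zero.1 hb).resolve_right (neg_ne_zero.2 hgx)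
  have hs : Real.sin (l * (2 * Real.pi / m)) = 0 := by
    have := eval_S_two_mul_cos (2 * Real.pi / m) (l - 1)
    rw [hS', hb', zero_mul] at this
    simpa using this.symm
  rw [hb', add_zero, sub_eq_zero] at ha
  have hc := eval_S_two_mul_cos (2 * Real.pi / m) l
  rw [hS, ha, one_mul] at hc
  have hcos : Real.cos (l * (2 * Real.pi / m)) = 1 := by
    push_cast at hc
    rw [add_mul, one_mul, Real.sin_add, hs, zero_mul, zero_add] at hc
    exact mul_right_cancel₀ hsin (by rw [← hc, one_mul])
  have hlpos : (0 : ℝ) < l := by exact_mod_cast hl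
  have hmpos : (0 : ℝ) < m := by positivity
  have hlt : (l : ℝ) < m := by exact_mod_cast hlm
  have hlt' : (l : ℝ) * (2 * Real.pi / m) < 2 * Real.pi := by
    rw [← mul_div_assoc, div_lt_iff₀ hmpos]
    nlinarith
  have hzero := (Real.cos_eq_one_iff_of_lt_of_lt (by
    have : 0 < (l : ℝ) * (2 * Real.pi / m) := by positivity
    linarith) hlt').1 hcos
  have : 0 < (l : ℝ) * (2 * Real.pi / m) := by positivity
  linarith

variable {B : Type*} (M : CoxeterMatrix B)

/-- The coroot functional `v ↦ 2⟨αᵢ, v⟩` of the geometric representation. -/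
noncomputable def coroot (i : B) : Dual ℝ (B →₀ ℝ) :=
  Finsupp.linearCombination ℝ fun j => -2 * Real.cos (Real.pi / M i j)

lemma coroot_single (i j : B) :
    coroot M i (Finsupp.single j 1) = -2 * Real.cos (Real.pi / M i j) := by
  simp [coroot]

lemma coroot_self (i : B) : coroot M i (Finsupp.single i 1) = 2 := by
  simp [coroot_single]

lemma coroot_mul_coroot (i j : B) :
    coroot M i (Finsupp.single j 1) * coroot M j (Finsupp.single i 1) =
      4 * Real.cos (Real.pi / M i j) ^ 2 := by
  rw [coroot_single, coroot_single, M.symmetric j i]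
  ring

/-- The simple reflections of the geometric representation. -/
noncomputable def simpleReflection (i : B) : (B →₀ ℝ) ≃ₗ[ℝ] (B →₀ ℝ) :=
  reflection (coroot_self M i)

lemma simpleReflection_apply (i : B) (z : B →₀ ℝ) :
    simpleReflection M i z = z - coroot M i z • Finsupp.single i 1 := rfl

lemma simpleReflection_isLiftable : M.IsLiftable (simpleReflection M) := by
  intro i j
  rcases Nat.lt_or_ge (M i j) 3 with h | h
  · have hcases : M i j = 0 ∨ M i j = 1 ∨ M i j = 2 := by omega
    rcases hcases with h0 | h1 | h2
    · rw [h0, pow_zero]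
    · have hij : i = j := by
        by_contra hne
        exact M.off_diagonal i j hne h1
      subst hij
      rw [h1, pow_one]
      ext1 z
      exact involutive_reflection (coroot_self M i) z
    · have hz : coroot M i (Finsupp.single j 1) = 0 := by simp [coroot_single, h2]
      have hz' : coroot M j (Finsupp.single i 1) = 0 := by
        simp [coroot_single, M.symmetric j i, h2]
      rw [h2, pow_two]
      ext1 z
      simp only [LinearEquiv.mul_apply, simpleReflection_apply, map_sub, map_smul, hz, hz',
        coroot_self, LinearEquiv.coe_one, id]
      module
  · exact reflection_mul_reflection_pow_eq_one _ _ h (coroot_mul_coroot M i j)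

/-- In a Coxeter group the product `sᵢ sⱼ` has order exactly `m_{ij}`. -/
lemma simple_mul_simple_pow_ne_one {i j : B} (hij : i ≠ j) {l : ℕ} (hl : 0 < l)
    (hlm : l < M i j) :
    (M.toCoxeterSystem.simple i * M.toCoxeterSystem.simple j) ^ l ≠ 1 := by
  intro h
  have h' := congrArg (M.toCoxeterSystem.lift ⟨_, simpleReflection_isLiftable M⟩) h
  rw [map_pow, map_mul, CoxeterSystem.lift_apply_simple, CoxeterSystem.lift_apply_simple,
    map_one] at h'
  have hx := congrArg (fun e : (B →₀ ℝ) ≃ₗ[ℝ] (B →₀ ℝ) => e (Finsupp.single i 1)) h'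
  rcases Nat.lt_or_ge (M i j) 3 with hm | hm
  · have h2 : M i j = 2 := by omega
    have h1 : l = 1 := by omega
    have hz' : coroot M j (Finsupp.single i 1) = 0 := by
      simp [coroot_single, M.symmetric j i, h2]
    subst h1
    have := congrArg (fun v : B →₀ ℝ => v i) hx
    simp [LinearEquiv.mul_apply, simpleReflection_apply, hz', coroot_self] at this
  · refine reflection_mul_reflection_pow_apply_self_ne (coroot_self M i) (coroot_self M j) ?_ hm
      (coroot_mul_coroot M i j) ?_ hl hlm hx
    · rw [LinearIndependent.pair_iff]
      intro a b hab
      have ha := DFunLike.congr_fun hab i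
      have hb := DFunLike.congr_fun hab j
      constructor
      · simpa [Finsupp.single_apply, hij.symm] using ha
      · simpa [Finsupp.single_apply, hij] using hb
    · rw [coroot_single, M.symmetric j i]
      have hm' : (3 : ℝ) ≤ M i j := by exact_mod_cast hm
      have hpi := Real.pi_pos
      have hpos : 0 < Real.cos (Real.pi / M i j) := by
        apply Real.cos_pos_of_mem_Ioo
        constructor
        · have : 0 < Real.pi / M i j := by positivity
          linarith
        · rw [div_lt_iff₀ (by linarith)]
          nlinarith
      nlinarith

end Geometric

section ReflectionSign

variable {B : Type*} (M : CoxeterMatrix B)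

local notation "𝔰" => CoxeterSystem.simple (CoxeterMatrix.toCoxeterSystem M)

lemma endMul_apply {α : Type*} (f g : Function.End α) (p : α) : (f * g) p = f (g p) := rfl

lemma endOne_apply {α : Type*} (p : α) : (1 : Function.End α) p = p := rfl

lemma simple_mul_pow_mul_simple (i j : B) (n : ℕ) :
    𝔰 j * (𝔰 i * 𝔰 j) ^ n = ((𝔰 i * 𝔰 j)⁻¹) ^ n * 𝔰 j := by
  induction n with
  | zero => simp
  | succ n ih =>
    rw [pow_succ, ← mul_assoc, ih, pow_succ]
    simp [-CoxeterMatrix.toCoxeterSystem_simple, mul_assoc]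

open Classical in
/-- Conjugation by the simple reflection `sᵢ`, recording a sign each time `sᵢ` itself is met. -/
noncomputable def signedConjSimple (i : B) : Function.End (M.Group × ℤˣ) :=
  fun p => (𝔰 i * p.1 * 𝔰 i, (if p.1 = 𝔰 i then -1 else 1) * p.2)

open Classical in
lemma signedConjSimple_mul_pow_apply (i j : B) (n : ℕ) (p : M.Group × ℤˣ) :
    ((signedConjSimple M i * signedConjSimple M j) ^ n) p =
      ((𝔰 i * 𝔰 j) ^ n * p.1 * ((𝔰 i * 𝔰 j) ^ n)⁻¹,
        (∏ l ∈ Finset.range (2 * n),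
          if p.1 = ((𝔰 i * 𝔰 j)⁻¹) ^ l * 𝔰 j then (-1 : ℤˣ) else 1) * p.2) := by
  induction n with
  | zero => simp [endOne_apply]
  | succ n ih =>
    obtain ⟨t, ε⟩ := p
    have h1 : (𝔰 i * 𝔰 j) ^ n * t * ((𝔰 i * 𝔰 j) ^ n)⁻¹ = 𝔰 j ↔
        t = ((𝔰 i * 𝔰 j)⁻¹) ^ (2 * n) * 𝔰 j := by
      rw [mul_inv_eq_iff_eq_mul, simple_mul_pow_mul_simple, two_mul, pow_add, mul_assoc,
        inv_pow, ← eq_inv_mul_iff_mul_eq]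
    have h2 : 𝔰 j * ((𝔰 i * 𝔰 j) ^ n * t * ((𝔰 i * 𝔰 j) ^ n)⁻¹) * 𝔰 j = 𝔰 i ↔
        t = ((𝔰 i * 𝔰 j)⁻¹) ^ (2 * n + 1) * 𝔰 j := by
      have h3 : ((𝔰 i * 𝔰 j)⁻¹) ^ (2 * n + 1) * 𝔰 j =
          ((𝔰 i * 𝔰 j) ^ n)⁻¹ * (𝔰 j * 𝔰 i * 𝔰 j) * (𝔰 i * 𝔰 j) ^ n := by
        rw [mul_assoc, mul_assoc, simple_mul_pow_mul_simple, two_mul, add_assoc, pow_add,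
          pow_succ' _ n, inv_pow]
        simp [-CoxeterMatrix.toCoxeterSystem_simple, mul_assoc]
      have h4 : ∀ x : M.Group, 𝔰 j * x * 𝔰 j = 𝔰 i ↔ x = 𝔰 j * 𝔰 i * 𝔰 j := fun x => by
        rw [← mul_inv_eq_iff_eq_mul, ← inv_mul_eq_iff_eq_mul, CoxeterSystem.inv_simple, mul_assoc]
      rw [h3, h4, mul_inv_eq_iff_eq_mul, ← eq_inv_mul_iff_mul_eq, mul_assoc (_⁻¹)]
    rw [pow_succ', endMul_apply, ih, endMul_apply]
    simp only [signedConjSimple, h1, h2]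
    rw [mul_add_one, Finset.prod_range_succ, Finset.prod_range_succ, pow_succ' (𝔰 i * 𝔰 j)]
    refine Prod.ext ?_ ?_
    · simp [-CoxeterMatrix.toCoxeterSystem_simple, mul_assoc]
    · simp only
      ac_rfl

lemma signedConjSimple_isLiftable : M.IsLiftable (signedConjSimple M) := by
  classical
  intro i j
  refine funext fun p => ?_
  rw [signedConjSimple_mul_pow_apply, two_mul, Finset.prod_range_add]
  simp only [pow_add, inv_pow, CoxeterSystem.simple_mul_simple_pow, inv_one, one_mul, mul_one]
  rw [← Finset.prod_mul_distrib]
  simp [Int.units_mul_self, endOne_apply]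

/-- The action of a Coxeter group on signed elements, by conjugation. -/
noncomputable def signedConj : M.Group →* Function.End (M.Group × ℤˣ) :=
  M.toCoxeterSystem.lift ⟨_, signedConjSimple_isLiftable M⟩

/-- The sign picked up by `t` when it is conjugated by `w`. For a reflection `t` it is `-1`
exactly when `t` is a right inversion of `w`. -/
noncomputable def reflSign (w t : M.Group) : ℤˣ := (signedConj M w (t, 1)).2

lemma signedConj_simple (i : B) : signedConj M (𝔰 i) = signedConjSimple M i :=
  CoxeterSystem.lift_apply_simple _ _ _

lemma signedConj_apply (w t : M.Group) (ε : ℤˣ) :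
    signedConj M w (t, ε) = (w * t * w⁻¹, reflSign M w t * ε) := by
  induction w using M.toCoxeterSystem.simple_induction_left generalizing ε with
  | one => simp [reflSign, endOne_apply]
  | mul_simple_left w i ih =>
    rw [reflSign, map_mul, endMul_apply, endMul_apply, ih, ih, signedConj_simple, signedConjSimple]
    simp [-CoxeterMatrix.toCoxeterSystem_simple, mul_assoc, signedConjSimple]

lemma reflSign_mul (w w' t : M.Group) :
    reflSign M (w * w') t = reflSign M w (w' * t * w'⁻¹) * reflSign M w' t := by
  rw [reflSign, map_mul, endMul_apply, signedConj_apply, signedConj_apply, mul_one]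

lemma reflSign_one (t : M.Group) : reflSign M 1 t = 1 := by simp [reflSign, endOne_apply]

open Classical in
lemma reflSign_simple (i : B) (t : M.Group) :
    reflSign M (𝔰 i) t = if t = 𝔰 i then -1 else 1 := by
  rw [reflSign, signedConj_simple, signedConjSimple]
  simp

/-- The alternating product `sᵢ sⱼ sᵢ ⋯` with `k` factors in the Coxeter group. -/
def altProd (i j : B) : ℕ → M.Group
  | 0 => 1
  | k + 1 => 𝔰 i * altProd j i k

lemma altProd_succ (i j : B) (k : ℕ) : altProd M i j (k + 1) = 𝔰 i * altProd M j i k := rfl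

lemma altProd_mul_simple (i j : B) (k : ℕ) :
    altProd M i j k * 𝔰 (if k % 2 = 0 then i else j) = altProd M i j (k + 1) := by
  induction k generalizing i j with
  | zero => simp [altProd]
  | succ k ih =>
    rw [altProd_succ, mul_assoc, altProd_succ M i j (k + 1), ← ih j i]
    congr 3
    rcases Nat.mod_two_eq_zero_or_one k with h | h <;> simp [Nat.add_mod, h]

lemma altProd_mul_inv (i j : B) (k : ℕ) :
    altProd M i j k * (altProd M j i k)⁻¹ = (𝔰 i * 𝔰 j) ^ k := by
  induction k generalizing i j with
  | zero => simp [altProd]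
  | succ k ih =>
    rw [altProd_succ, altProd_succ, mul_inv_rev, CoxeterSystem.inv_simple, mul_assoc, ← mul_assoc
      (altProd M j i k), ih, ← mul_assoc, ← mul_pow_mul,
      mul_assoc, ← pow_succ]

lemma altProd_order (i j : B) : altProd M i j (M i j) = altProd M j i (M i j) := by
  rw [← mul_inv_eq_one, altProd_mul_inv, CoxeterSystem.simple_mul_simple_pow]

lemma altProd_ne {i j : B} (hij : i ≠ j) {k : ℕ} (hk : 0 < k) (hkm : k < M i j) :
    altProd M i j k ≠ altProd M j i k := by
  rw [Ne, ← mul_inv_eq_one, altProd_mul_inv]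
  exact simple_mul_simple_pow_ne_one M hij hk hkm

lemma reflSign_altProd {i j : B} (hij : i ≠ j) {k : ℕ} (hkm : k < M i j) :
    reflSign M (altProd M i j k) (𝔰 (if k % 2 = 0 then i else j)) = 1 := by
  induction k generalizing i j with
  | zero => simp [altProd, reflSign_one]
  | succ k ih =>
    have hpar : (if (k + 1) % 2 = 0 then i else j) = if k % 2 = 0 then j else i := by
      rcases Nat.mod_two_eq_zero_or_one k with h | h <;> simp [Nat.add_mod, h]
    rw [altProd_succ, reflSign_mul, hpar, ih hij.symm (by rw [M.symmetric]; omega), mul_one,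
      reflSign_simple, if_neg]
    rw [mul_inv_eq_iff_eq_mul, altProd_mul_simple, ← altProd_succ]
    exact altProd_ne M hij.symm k.succ_pos (by rwa [M.symmetric])

lemma simple_mul_altProd {i j : B} (hm : M i j ≠ 0) :
    𝔰 i * altProd M j i (M i j - 1) =
      altProd M j i (M i j - 1) * 𝔰 (if M i j % 2 = 0 then i else j) := by
  obtain ⟨k, hk⟩ := Nat.exists_eq_succ_of_ne_zero hm
  have hpar : (if M i j % 2 = 0 then i else j) = if k % 2 = 0 then j else i := by
    rcases Nat.mod_two_eq_zero_or_one k with h | h <;> simp [hk, Nat.add_mod, h]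
  have := altProd_order M i j
  rw [hpar]
  simp only [hk, Nat.succ_eq_add_one, Nat.add_sub_cancel] at this ⊢
  rw [altProd_mul_simple, ← altProd_succ, this]

lemma reflSign_altProd_pred {i j : B} (hij : i ≠ j) (hm : M i j ≠ 0) :
    reflSign M (altProd M j i (M i j - 1)) (𝔰 (if M i j % 2 = 0 then i else j)) = 1 := by
  obtain ⟨k, hk⟩ := Nat.exists_eq_succ_of_ne_zero hm
  have hpar : (if M i j % 2 = 0 then i else j) = if k % 2 = 0 then j else i := by
    rcases Nat.mod_two_eq_zero_or_one k with h | h <;> simp [hk, Nat.add_mod, h]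
  rw [hpar, hk]
  exact reflSign_altProd M hij.symm (by rw [M.symmetric]; omega)

end ReflectionSign

section Representation

variable {B : Type*} (M : CoxeterMatrix B)

local notation "𝔰" => CoxeterSystem.simple (CoxeterMatrix.toCoxeterSystem M)

/-- The representation space of `Ĥ(W)`: it has a basis of pairs `(ω, w)` where `ω` is a word in
elements of `W` and `w ∈ W`. -/
abbrev WordSpace : Type _ := (List M.Group × M.Group) →₀ ℚ

/-- The product of the signs picked up by the letters of a word under conjugation by `w`. -/
noncomputable def wordSign (w : M.Group) (ω : List M.Group) : ℤˣ :=
  (ω.map (reflSign M w)).prod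

/-- Letterwise conjugation of a word. -/
def conjWord (w : M.Group) (ω : List M.Group) : List M.Group := ω.map (fun t => w * t * w⁻¹)

variable {M} in
lemma wordSpace_hom_ext {f g : Module.End ℚ (WordSpace M)}
    (h : ∀ ω w, f (Finsupp.single (ω, w) 1) = g (Finsupp.single (ω, w) 1)) : f = g :=
  Finsupp.lhom_ext' fun p => LinearMap.ext_ring (h p.1 p.2)

lemma conjWord_mul (w w' : M.Group) (ω : List M.Group) :
    conjWord M (w * w') ω = conjWord M w (conjWord M w' ω) := by
  simp [conjWord, mul_assoc]

lemma conjWord_one (ω : List M.Group) : conjWord M 1 ω = ω := by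
  simp [conjWord]

lemma wordSign_mul (w w' : M.Group) (ω : List M.Group) :
    wordSign M (w * w') ω = wordSign M w (conjWord M w' ω) * wordSign M w' ω := by
  induction ω with
  | nil => simp [wordSign, conjWord]
  | cons t ω ih =>
    simp only [wordSign, conjWord, List.map_cons, List.prod_cons] at ih ⊢
    rw [reflSign_mul, ih]
    ac_rfl

lemma wordSign_one (ω : List M.Group) : wordSign M 1 ω = 1 := by
  induction ω with
  | nil => simp [wordSign]
  | cons t ω ih =>
    simp only [wordSign, List.map_cons, List.prod_cons] at ih ⊢
    rw [reflSign_one, ih, one_mul]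

/-- The signed action of `W` on `WordSpace M`. -/
noncomputable def wordRep : M.Group →* Module.End ℚ (WordSpace M) where
  toFun w := Finsupp.linearCombination ℚ fun p =>
    ((wordSign M w p.1 : ℤˣ) : ℤ) • Finsupp.single (conjWord M w p.1, w * p.2) 1
  map_one' := wordSpace_hom_ext fun ω w => by
    simp [wordSign_one, conjWord_one]
  map_mul' w w' := wordSpace_hom_ext fun ω v => by
    simp only [Finsupp.linearCombination_single, one_smul, Module.End.mul_apply, map_zsmul,
      wordSign_mul, conjWord_mul, Units.val_mul, mul_smul, mul_assoc]
    rw [smul_comm]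

lemma wordRep_single (w : M.Group) (ω : List M.Group) (v : M.Group) :
    wordRep M w (Finsupp.single (ω, v) 1) =
      ((wordSign M w ω : ℤˣ) : ℤ) • Finsupp.single (conjWord M w ω, w * v) 1 := by
  simp [wordRep]

open Classical in
/-- The nilpotent operator adding the letter `t` in front of a word. -/
noncomputable def consLetter (t : M.Group) : Module.End ℚ (WordSpace M) :=
  Finsupp.linearCombination ℚ fun p =>
    if p.1.head? = some t then 0 else Finsupp.single (t :: p.1, p.2) 1

open Classical in
lemma consLetter_single (t : M.Group) (ω : List M.Group) (v : M.Group) :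
    consLetter M t (Finsupp.single (ω, v) 1) =
      if ω.head? = some t then 0 else Finsupp.single (t :: ω, v) 1 := by
  simp [consLetter]

lemma consLetter_mul_self (t : M.Group) : consLetter M t * consLetter M t = 0 :=
  wordSpace_hom_ext fun ω v => by
    rw [Module.End.mul_apply, consLetter_single]
    split_ifs with h
    · simp
    · simp [consLetter_single]

lemma wordRep_mul_consLetter (w t : M.Group) :
    wordRep M w * consLetter M t =
      ((reflSign M w t : ℤˣ) : ℤ) • (consLetter M (w * t * w⁻¹) * wordRep M w) :=
  wordSpace_hom_ext fun ω v => by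
    have hinj : Function.Injective fun x : M.Group => w * x * w⁻¹ := fun a b h => by simpa using h
    have h : (conjWord M w ω).head? = some (w * t * w⁻¹) ↔ ω.head? = some t := by
      rw [conjWord, List.head?_map]
      exact (Option.map_injective hinj).eq_iff (b := some t)
    rw [LinearMap.smul_apply, Module.End.mul_apply, Module.End.mul_apply, consLetter_single,
      wordRep_single, map_zsmul, consLetter_single]
    by_cases h' : ω.head? = some t
    · rw [if_pos h', if_pos (h.2 h')]
      simp
    · rw [if_neg h', if_neg (mt h.1 h'), wordRep_single, smul_smul]
      simp [wordSign, conjWord]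

/-- The operator by which `D_t` acts on `WordSpace M`. -/
noncomputable def demazureOp (t : M.Group) : Module.End ℚ (WordSpace M) :=
  consLetter M t + (1 / 2 : ℚ) • (1 - wordRep M t)

lemma wordRep_simple_mul_self (i : B) : wordRep M (𝔰 i) * wordRep M (𝔰 i) = 1 := by
  rw [← map_mul, CoxeterSystem.simple_mul_simple_self, map_one]

lemma wordRep_simple_mul_consLetter (i : B) :
    wordRep M (𝔰 i) * consLetter M (𝔰 i) = -(consLetter M (𝔰 i) * wordRep M (𝔰 i)) := by
  rw [wordRep_mul_consLetter, reflSign_simple]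
  simp

lemma demazureOp_simple_mul_self (i : B) :
    demazureOp M (𝔰 i) * demazureOp M (𝔰 i) = demazureOp M (𝔰 i) := by
  simp only [demazureOp, mul_add, add_mul, smul_mul_assoc, mul_smul_comm, mul_sub, sub_mul,
    consLetter_mul_self, wordRep_simple_mul_self, wordRep_simple_mul_consLetter, mul_one, one_mul]
  module

lemma wordRep_simple_mul_demazureOp (i : B) :
    wordRep M (𝔰 i) * demazureOp M (𝔰 i) + demazureOp M (𝔰 i) * wordRep M (𝔰 i) =
      wordRep M (𝔰 i) - 1 := by
  simp only [demazureOp, mul_add, add_mul, smul_mul_assoc, mul_smul_comm, mul_sub, sub_mul,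
    wordRep_simple_mul_self, wordRep_simple_mul_consLetter, mul_one, one_mul]
  module

lemma wordRep_mul_demazureOp {w t : M.Group} (h : reflSign M w t = 1) :
    wordRep M w * demazureOp M t = demazureOp M (w * t * w⁻¹) * wordRep M w := by
  have h' : wordRep M (w * t * w⁻¹) * wordRep M w = wordRep M w * wordRep M t := by
    rw [← map_mul, ← map_mul]
    simp
  simp only [demazureOp, mul_add, add_mul, smul_mul_assoc, mul_smul_comm, mul_sub, sub_mul,
    wordRep_mul_consLetter, h, h', mul_one, one_mul, Units.val_one, one_smul]

/-- The action of the free algebra on `WordSpace M`. -/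
noncomputable def freeWordAction : F B →ₐ[ℤ] Module.End ℚ (WordSpace M) :=
  FreeAlgebra.lift ℤ fun g =>
    match g with
    | Gen.s i => wordRep M (𝔰 i)
    | Gen.D i => demazureOp M (𝔰 i)

lemma freeWordAction_fs (i : B) : freeWordAction M (fs i) = wordRep M (𝔰 i) := by
  simp only [freeWordAction, fs, FreeAlgebra.lift_ι_apply]

lemma freeWordAction_fD (i : B) : freeWordAction M (fD i) = demazureOp M (𝔰 i) := by
  simp only [freeWordAction, fD, FreeAlgebra.lift_ι_apply]

lemma freeWordAction_altS (i j : B) (k : ℕ) :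
    freeWordAction M (altS i j k) = wordRep M (altProd M i j k) := by
  induction k generalizing i j with
  | zero => simp [altS, altProd]
  | succ k ih => rw [altS, altProd, map_mul, map_mul, ih, freeWordAction_fs]

lemma freeWordAction_rel {x y : F B} (h : Rel M x y) :
    freeWordAction M x = freeWordAction M y := by
  induction h with
  | s_sq i => simp only [map_mul, map_one, freeWordAction_fs, wordRep_simple_mul_self]
  | D_sq i => simp only [map_mul, freeWordAction_fD, demazureOp_simple_mul_self]
  | sD i =>
    simp only [map_add, map_sub, map_mul, map_one, freeWordAction_fs, freeWordAction_fD,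
      wordRep_simple_mul_demazureOp]
  | coxeter i j =>
    rw [map_pow, map_mul, freeWordAction_fs, freeWordAction_fs, ← map_mul, ← map_pow,
      CoxeterSystem.simple_mul_simple_pow, map_one, map_one]
  | braidLin i j hij hm =>
    rw [map_mul, map_mul, freeWordAction_fD, freeWordAction_fD, freeWordAction_altS,
      wordRep_mul_demazureOp M (reflSign_altProd_pred M hij hm), ← simple_mul_altProd M hm,
      mul_inv_cancel_right]

/-- The representation of `Ĥ(W)` on `WordSpace M`. -/
noncomputable def wordAction : HW M →ₐ[ℤ] Module.End ℚ (WordSpace M) :=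
  RingQuot.liftAlgHom ℤ ⟨freeWordAction M, fun _ _ => freeWordAction_rel M⟩

lemma wordAction_hs (i : B) : wordAction M (hs M i) = wordRep M (𝔰 i) := by
  rw [wordAction, hs, RingQuot.liftAlgHom_mkAlgHom_apply, freeWordAction_fs]

lemma wordAction_hD (i : B) : wordAction M (hD M i) = demazureOp M (𝔰 i) := by
  rw [wordAction, hD, RingQuot.liftAlgHom_mkAlgHom_apply, freeWordAction_fD]

end Representation

section Basis

variable {B : Type*} {M : CoxeterMatrix B}

local notation "𝔰" => CoxeterSystem.simple (CoxeterMatrix.toCoxeterSystem M)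

/-- The conditions pinning down the canonical homomorphism `π` and the family `(D_t)`. -/
structure IsReflFamily (π : M.Group →* (HW M)ˣ) (Dfam : Refl M → HW M) :
    Prop where
  coe_simple : ∀ i : B, ((π (𝔰 i) : (HW M)ˣ) : HW M) = hs M i
  simple : ∀ (i : B) (h : M.toCoxeterSystem.IsReflection (𝔰 i)), Dfam ⟨𝔰 i, h⟩ = hD M i
  conj : ∀ (i : B) (t : Refl M), (t : M.Group) ≠ 𝔰 i →
    ∀ h : M.toCoxeterSystem.IsReflection (𝔰 i * (t : M.Group) * 𝔰 i),
      hs M i * Dfam t * hs M i = Dfam ⟨𝔰 i * (t : M.Group) * 𝔰 i, h⟩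

lemma refl_induction {P : Refl M → Prop}
    (simple : ∀ (i : B) (h : M.toCoxeterSystem.IsReflection (𝔰 i)), P ⟨𝔰 i, h⟩)
    (conj : ∀ (i : B) (t : Refl M), (t : M.Group) ≠ 𝔰 i →
      ∀ h : M.toCoxeterSystem.IsReflection (𝔰 i * (t : M.Group) * 𝔰 i), P t → P ⟨_, h⟩)
    (t : Refl M) : P t := by
  obtain ⟨t, ht⟩ := t
  have key : ∀ w k, ∀ h : M.toCoxeterSystem.IsReflection (w * 𝔰 k * w⁻¹), P ⟨_, h⟩ := by
    intro w k
    induction w using M.toCoxeterSystem.simple_induction_left with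
    | one =>
      intro h
      have e : (1 : M.Group) * 𝔰 k * 1⁻¹ = 𝔰 k := by simp
      simp only [e]
      exact simple k _
    | mul_simple_left w j ih =>
      intro h
      have e : 𝔰 j * w * 𝔰 k * (𝔰 j * w)⁻¹ = 𝔰 j * (w * 𝔰 k * w⁻¹) * 𝔰 j := by
        rw [mul_inv_rev, CoxeterSystem.inv_simple]
        simp only [mul_assoc]
      have hw : M.toCoxeterSystem.IsReflection (w * 𝔰 k * w⁻¹) := ⟨w, k, rfl⟩
      simp only [e] at h ⊢
      by_cases hj : w * 𝔰 k * w⁻¹ = 𝔰 j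
      · have e' : 𝔰 j * (w * 𝔰 k * w⁻¹) * 𝔰 j = 𝔰 j := by
          rw [hj, CoxeterSystem.simple_mul_simple_self, one_mul]
        simp only [e']
        exact simple j _
      · exact conj j ⟨_, hw⟩ hj h (ih hw)
  obtain ⟨w, k, rfl⟩ := ht
  exact key w k _

lemma hs_mul_self (i : B) : hs M i * hs M i = 1 := by
  rw [hs, ← map_mul, RingQuot.mkAlgHom_rel ℤ (Rel.s_sq i), map_one]

lemma hD_mul_self (i : B) : hD M i * hD M i = hD M i := by
  rw [hD, ← map_mul, RingQuot.mkAlgHom_rel ℤ (Rel.D_sq i)]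

lemma hs_mul_hD (i : B) : hs M i * hD M i = hs M i - 1 - hD M i * hs M i := by
  have h := RingQuot.mkAlgHom_rel ℤ (Rel.sD (M := M) i)
  rw [map_add, map_sub, map_mul, map_mul, map_one] at h
  change hs M i * hD M i + hD M i * hs M i = hs M i - 1 at h
  exact eq_sub_of_add_eq h

variable {π : M.Group →* (HW M)ˣ} {Dfam : Refl M → HW M}

lemma IsReflFamily.hs_mul_Dfam (H : IsReflFamily π Dfam) {i : B} {t : Refl M}
    (hti : (t : M.Group) ≠ 𝔰 i)
    (h : M.toCoxeterSystem.IsReflection (𝔰 i * (t : M.Group) * 𝔰 i)) :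
    hs M i * Dfam t = Dfam ⟨_, h⟩ * hs M i := by
  rw [← H.conj i t hti h, mul_assoc, hs_mul_self, mul_one]

lemma isReflection_conj_simple (i : B) (t : Refl M) :
    M.toCoxeterSystem.IsReflection (𝔰 i * (t : M.Group) * 𝔰 i) := by
  simpa only [CoxeterSystem.inv_simple] using t.2.conj (𝔰 i)

lemma IsReflFamily.Dfam_mul_self (H : IsReflFamily π Dfam) (t : Refl M) :
    Dfam t * Dfam t = Dfam t := by
  induction t using refl_induction with
  | simple i h => rw [H.simple, hD_mul_self]
  | conj i t hti h ih =>
    rw [← H.conj i t hti h]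
    calc _ = hs M i * Dfam t * (hs M i * hs M i) * Dfam t * hs M i := by simp only [mul_assoc]
      _ = hs M i * (Dfam t * Dfam t) * hs M i := by simp only [hs_mul_self, mul_one, mul_assoc]
      _ = _ := by rw [ih]

lemma IsReflFamily.wordAction_Dfam (H : IsReflFamily π Dfam) (t : Refl M) :
    wordAction M (Dfam t) = demazureOp M t := by
  induction t using refl_induction with
  | simple i h => rw [H.simple, wordAction_hD]
  | conj i t hti h ih =>
    rw [← H.conj i t hti h, map_mul, map_mul, ih, wordAction_hs, wordRep_mul_demazureOp,
      mul_assoc, wordRep_simple_mul_self, mul_one, CoxeterSystem.inv_simple]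
    rw [reflSign_simple, if_neg hti]

lemma IsReflFamily.wordAction_coe (H : IsReflFamily π Dfam) (w : M.Group) :
    wordAction M (π w : HW M) = wordRep M w := by
  induction w using M.toCoxeterSystem.simple_induction_left with
  | one => simp
  | mul_simple_left w i ih =>
    rw [map_mul, Units.val_mul, map_mul, H.coe_simple, wordAction_hs, ih, map_mul]

/-- The product `D_{t₁} ⋯ D_{tₖ} π(w)`. -/
def monomial (π : M.Group →* (HW M)ˣ) (Dfam : Refl M → HW M) (ω : List (Refl M)) (w : M.Group) :
    HW M :=
  (ω.map Dfam).prod * π w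

lemma monomial_cons (t : Refl M) (ω : List (Refl M)) (w : M.Group) :
    monomial π Dfam (t :: ω) w = Dfam t * monomial π Dfam ω w := by
  simp [monomial, mul_assoc]

variable (M) in
/-- The index set of the basis of `Ĥ(W)`: a word of reflections without equal neighbours,
together with an element of `W`. -/
abbrev MonomialIndex : Type _ :=
  {ω : List (Refl M) // ω.IsChain (· ≠ ·)} × M.Group

/-- The span of the monomials without equal neighbours. -/
def monomialSpan (π : M.Group →* (HW M)ˣ) (Dfam : Refl M → HW M) : Submodule ℤ (HW M) :=
  Submodule.span ℤ (Set.range fun p : MonomialIndex M => monomial π Dfam p.1.1 p.2)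

lemma monomial_mem_span {ω : List (Refl M)} (hω : ω.IsChain (· ≠ ·)) (w : M.Group) :
    monomial π Dfam ω w ∈ monomialSpan π Dfam :=
  Submodule.subset_span ⟨(⟨ω, hω⟩, w), rfl⟩

lemma mul_mem_monomialSpan {a : HW M}
    (h : ∀ ω : List (Refl M), ω.IsChain (· ≠ ·) → ∀ w,
      a * monomial π Dfam ω w ∈ monomialSpan π Dfam)
    {x : HW M} (hx : x ∈ monomialSpan π Dfam) : a * x ∈ monomialSpan π Dfam := by
  have : monomialSpan π Dfam ≤ (monomialSpan π Dfam).comap (LinearMap.mulLeft ℤ a) := by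
    conv_lhs => rw [monomialSpan]
    rw [Submodule.span_le]
    rintro _ ⟨p, rfl⟩
    exact h _ p.1.2 _
  exact this hx

lemma IsReflFamily.Dfam_mul_mem_span (H : IsReflFamily π Dfam) (t : Refl M) {x : HW M}
    (hx : x ∈ monomialSpan π Dfam) : Dfam t * x ∈ monomialSpan π Dfam := by
  refine mul_mem_monomialSpan (fun ω hω w => ?_) hx
  cases ω with
  | nil =>
    rw [← monomial_cons]
    exact monomial_mem_span (by simp) w
  | cons a ω =>
    by_cases h : t = a
    · subst h
      rw [monomial_cons, ← mul_assoc, H.Dfam_mul_self, ← monomial_cons]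
      exact monomial_mem_span hω w
    · rw [← monomial_cons]
      exact monomial_mem_span (List.isChain_cons_cons.2 ⟨h, hω⟩) w

lemma IsReflFamily.hs_mul_mem_span (H : IsReflFamily π Dfam) (i : B) {x : HW M}
    (hx : x ∈ monomialSpan π Dfam) : hs M i * x ∈ monomialSpan π Dfam := by
  refine mul_mem_monomialSpan (fun ω hω w => ?_) hx
  induction ω with
  | nil =>
    have : hs M i * monomial π Dfam [] w = monomial π Dfam [] (𝔰 i * w) := by
      simp only [monomial, List.map_nil, List.prod_nil, one_mul, map_mul, Units.val_mul,
        H.coe_simple]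
    rw [this]
    exact monomial_mem_span (by simp) _
  | cons t ω ih =>
    have hω' : ω.IsChain (· ≠ ·) := hω.tail
    rw [monomial_cons, ← mul_assoc]
    by_cases hti : (t : M.Group) = 𝔰 i
    · obtain ⟨t, ht⟩ := t
      obtain rfl : t = 𝔰 i := hti
      rw [H.simple, hs_mul_hD, sub_mul, sub_mul, mul_assoc, one_mul, ← H.simple i ht]
      exact sub_mem (sub_mem (ih hω') (monomial_mem_span hω' w))
        (H.Dfam_mul_mem_span _ (ih hω'))
    · rw [H.hs_mul_Dfam hti (isReflection_conj_simple i t), mul_assoc]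
      exact H.Dfam_mul_mem_span _ (ih hω')

lemma IsReflFamily.monomialSpan_eq_top (H : IsReflFamily π Dfam) : monomialSpan π Dfam = ⊤ := by
  have key : ∀ f : F B, ∀ x ∈ monomialSpan π Dfam,
      RingQuot.mkAlgHom ℤ (Rel M) f * x ∈ monomialSpan π Dfam := by
    intro f
    induction f using FreeAlgebra.induction with
    | grade0 n =>
      intro x hx
      rw [AlgHom.commutes, ← Algebra.smul_def]
      exact Submodule.smul_mem _ n hx
    | grade1 g =>
      intro x hx
      cases g with
      | s i => exact H.hs_mul_mem_span i hx
      | D i =>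
        have h := M.toCoxeterSystem.isReflection_simple i
        have := H.Dfam_mul_mem_span ⟨_, h⟩ hx
        rwa [H.simple] at this
    | mul a b ha hb =>
      intro x hx
      rw [map_mul, mul_assoc]
      exact ha _ (hb _ hx)
    | add a b ha hb =>
      intro x hx
      rw [map_add, add_mul]
      exact add_mem (ha _ hx) (hb _ hx)
  have hone : (1 : HW M) ∈ monomialSpan π Dfam := by
    have := monomial_mem_span (π := π) (Dfam := Dfam) (ω := []) (by simp) 1
    simpa [monomial] using this
  refine Submodule.eq_top_iff'.2 fun x => ?_
  obtain ⟨f, rfl⟩ := RingQuot.mkAlgHom_surjective ℤ (Rel M) x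
  simpa using key f 1 hone

variable (M) in
/-- The subspace spanned by words of length less than `n`. -/
def shortWords (n : ℕ) : Submodule ℚ (WordSpace M) :=
  Finsupp.supported ℚ ℚ {p | p.1.length < n}

lemma single_mem_shortWords {n : ℕ} {ω : List M.Group} (h : ω.length < n) (w : M.Group) :
    Finsupp.single (ω, w) 1 ∈ shortWords M n :=
  Finsupp.single_mem_supported ℚ 1 h

lemma shortWords_mono {m n : ℕ} (h : m ≤ n) : shortWords M m ≤ shortWords M n :=
  Finsupp.supported_mono fun _ hp => lt_of_lt_of_le hp h

lemma map_mem_shortWords {m n : ℕ} {f : Module.End ℚ (WordSpace M)}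
    (h : ∀ ω w, ω.length < m → f (Finsupp.single (ω, w) 1) ∈ shortWords M n)
    {x : WordSpace M} (hx : x ∈ shortWords M m) : f x ∈ shortWords M n := by
  have : shortWords M m ≤ (shortWords M n).comap f := by
    rw [shortWords, Finsupp.supported_eq_span_single, Submodule.span_le]
    rintro _ ⟨p, hp, rfl⟩
    exact h p.1 p.2 hp
  exact this hx

lemma wordRep_mem_shortWords (w : M.Group) {n : ℕ} {x : WordSpace M} (hx : x ∈ shortWords M n) :
    wordRep M w x ∈ shortWords M n := by
  refine map_mem_shortWords (fun ω v h => ?_) hx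
  rw [wordRep_single]
  exact zsmul_mem (single_mem_shortWords (by simpa [conjWord] using h) _) _

lemma consLetter_mem_shortWords (t : M.Group) {n : ℕ} {x : WordSpace M}
    (hx : x ∈ shortWords M n) : consLetter M t x ∈ shortWords M (n + 1) := by
  refine map_mem_shortWords (fun ω v h => ?_) hx
  rw [consLetter_single]
  split_ifs
  · exact zero_mem _
  · exact single_mem_shortWords (by simpa using h) _

lemma demazureOp_sub_consLetter_mem_shortWords (t : M.Group) {n : ℕ} {x : WordSpace M}
    (hx : x ∈ shortWords M n) : demazureOp M t x - consLetter M t x ∈ shortWords M n := by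
  have : demazureOp M t x - consLetter M t x = (1 / 2 : ℚ) • (x - wordRep M t x) := by
    simp [demazureOp]
  rw [this]
  exact Submodule.smul_mem _ _ (sub_mem hx (wordRep_mem_shortWords t hx))

lemma demazureOp_mem_shortWords (t : M.Group) {n : ℕ} {x : WordSpace M}
    (hx : x ∈ shortWords M n) : demazureOp M t x ∈ shortWords M (n + 1) := by
  rw [← sub_add_cancel (demazureOp M t x) (consLetter M t x)]
  exact add_mem (shortWords_mono n.le_succ (demazureOp_sub_consLetter_mem_shortWords t hx))
    (consLetter_mem_shortWords t hx)

lemma IsReflFamily.wordAction_monomial (H : IsReflFamily π Dfam) {ω : List (Refl M)}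
    (hω : ω.IsChain (· ≠ ·)) (w : M.Group) :
    wordAction M (monomial π Dfam ω w) (Finsupp.single ([], 1) 1) -
      Finsupp.single (ω.map Subtype.val, w) 1 ∈ shortWords M ω.length := by
  induction ω with
  | nil =>
    simp only [monomial, List.map_nil, List.prod_nil, one_mul, H.wordAction_coe, wordRep_single]
    simp [wordSign, conjWord]
  | cons t ω ih =>
    have hcons : consLetter M t (Finsupp.single (ω.map Subtype.val, w) 1) =
        Finsupp.single ((t :: ω).map Subtype.val, w) 1 := by
      rw [consLetter_single, if_neg, List.map_cons]
      cases ω with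
      | nil => simp
      | cons a ω =>
        have := (List.isChain_cons_cons.1 hω).1
        simpa [Subtype.ext_iff, eq_comm] using this
    rw [monomial_cons, map_mul, Module.End.mul_apply, H.wordAction_Dfam, ← hcons]
    have h1 := demazureOp_mem_shortWords (t : M.Group) (ih hω.tail)
    have h2 := demazureOp_sub_consLetter_mem_shortWords (t : M.Group)
      (single_mem_shortWords (n := ω.length + 1) (ω := ω.map Subtype.val) (by simp) w)
    rw [map_sub] at h1
    simpa using add_mem h1 h2

lemma IsReflFamily.linearIndependent_monomial (H : IsReflFamily π Dfam) :
    LinearIndependent ℤ fun p : MonomialIndex M => monomial π Dfam p.1.1 p.2 := by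
  classical
  rw [linearIndependent_iff]
  intro l hl
  by_contra hne
  obtain ⟨p₀, hp₀, hmax⟩ := l.support.exists_max_image (fun p => p.1.1.length)
    (Finsupp.support_nonempty_iff.2 hne)
  let ev : HW M →ₗ[ℤ] ℚ :=
    (Finsupp.lapply (p₀.1.1.map Subtype.val, p₀.2) :
      WordSpace M →ₗ[ℚ] ℚ).toAddMonoidHom.toIntLinearMap ∘ₗ
    (LinearMap.applyₗ (Finsupp.single ([], 1) 1) :
      Module.End ℚ (WordSpace M) →ₗ[ℚ] WordSpace M).toAddMonoidHom.toIntLinearMap ∘ₗ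
    (wordAction M).toLinearMap
  have hev : ∀ p ∈ l.support, ev (monomial π Dfam p.1.1 p.2) = if p = p₀ then 1 else 0 := by
    intro p hp
    have h := H.wordAction_monomial p.1.2 p.2
    rw [shortWords, Finsupp.mem_supported'] at h
    have h0 := h (p₀.1.1.map Subtype.val, p₀.2) (by simpa using hmax p hp)
    rw [Finsupp.sub_apply, sub_eq_zero] at h0
    change (wordAction M (monomial π Dfam p.1.1 p.2) (Finsupp.single ([], 1) 1))
      (p₀.1.1.map Subtype.val, p₀.2) = _
    rw [h0, Finsupp.single_apply]
    refine if_congr ?_ rfl rfl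
    rw [Prod.mk.injEq, (List.map_injective_iff.2 Subtype.val_injective).eq_iff, Prod.ext_iff,
      Subtype.ext_iff]
  have h := congrArg ev hl
  rw [Finsupp.linearCombination_apply, Finsupp.sum, map_sum, map_zero,
    Finset.sum_congr rfl fun p hp => by rw [map_zsmul, hev p hp]] at h
  simp at h
  exact Finsupp.mem_support_iff.1 hp₀ h

lemma IsReflFamily.free (H : IsReflFamily π Dfam) : Module.Free ℤ (HW M) :=
  Module.Free.of_basis (Module.Basis.mk H.linearIndependent_monomial H.monomialSpan_eq_top.ge)

end Basis

section Contraction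

variable {R A : Type*} [CommRing R] [Ring A] [Algebra R A]

/-- Contraction of the left tensor factor with a linear functional. -/
noncomputable def contractLeft (φ : A →ₗ[R] R) : A ⊗[R] A →ₗ[R] A :=
  (TensorProduct.lid R A).toLinearMap ∘ₗ φ.rTensor A

lemma contractLeft_tmul (φ : A →ₗ[R] R) (a b : A) : contractLeft φ (a ⊗ₜ b) = φ a • b := by
  simp [contractLeft]

lemma contractLeft_map (φ : A →ₗ[R] R) (f g : A →ₗ[R] A) (x : A ⊗[R] A) :
    contractLeft φ (TensorProduct.map f g x) = g (contractLeft (φ ∘ₗ f) x) := by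
  induction x with
  | zero => simp
  | tmul a b => simp [contractLeft_tmul]
  | add x y hx hy => simp only [map_add, hx, hy]

lemma contractLeft_mem (φ : A →ₗ[R] R) {N : Submodule R A} {x : A ⊗[R] A}
    (hx : x ∈ LinearMap.range (N.subtype.lTensor A)) : contractLeft φ x ∈ N := by
  obtain ⟨y, rfl⟩ := hx
  induction y with
  | zero => simp
  | tmul a b => simpa [contractLeft_tmul] using N.smul_mem (φ a) b.2
  | add x y hx hy => simpa only [map_add] using add_mem hx hy

lemma tmul_mem_range_lTensor {N : Submodule R A} (a : A) {b : A} (hb : b ∈ N) :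
    a ⊗ₜ b ∈ LinearMap.range (N.subtype.lTensor A) :=
  ⟨a ⊗ₜ ⟨b, hb⟩, rfl⟩

lemma tmul_mem_range_rTensor {N : Submodule R A} {a : A} (ha : a ∈ N) (b : A) :
    a ⊗ₜ b ∈ LinearMap.range (N.subtype.rTensor A) :=
  ⟨⟨a, ha⟩ ⊗ₜ b, rfl⟩

lemma mem_range_lTensor_of_contractLeft [Module.Free R A] {N : Submodule R A} {x : A ⊗[R] A}
    (h : ∀ φ : A →ₗ[R] R, contractLeft φ x ∈ N) :
    x ∈ LinearMap.range (N.subtype.lTensor A) := by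
  classical
  let b := Module.Free.chooseBasis R A
  rw [← (TensorProduct.equivFinsuppOfBasisLeft (N := A) b).symm_apply_apply x,
    TensorProduct.equivFinsuppOfBasisLeft_symm_apply]
  refine sum_mem fun i _ => tmul_mem_range_lTensor _ ?_
  rw [TensorProduct.equivFinsuppOfBasisLeft_apply]
  exact h _

/-- The submodule `A ⊗ N + N ⊗ A` of `A ⊗ A`. -/
noncomputable abbrev hopfSum (N : Submodule R A) : Submodule R (A ⊗[R] A) :=
  LinearMap.range (N.subtype.lTensor A) ⊔ LinearMap.range (N.subtype.rTensor A)

lemma hopfSum_induction {N : Submodule R A} {P : Submodule R (A ⊗[R] A)}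
    (hl : ∀ a, ∀ b ∈ N, a ⊗ₜ b ∈ P) (hr : ∀ a ∈ N, ∀ b, a ⊗ₜ b ∈ P) : hopfSum N ≤ P := by
  refine sup_le ?_ ?_
  · rintro _ ⟨y, rfl⟩
    induction y with
    | zero => simp
    | tmul a b => exact hl a b b.2
    | add x y hx hy => simpa only [map_add] using add_mem hx hy
  · rintro _ ⟨y, rfl⟩
    induction y with
    | zero => simp
    | tmul a b => exact hr a a.2 b
    | add x y hx hy => simpa only [map_add] using add_mem hx hy

lemma tmul_mem_hopfSum_right {N : Submodule R A} (a : A) {b : A} (hb : b ∈ N) :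
    a ⊗ₜ b ∈ hopfSum N :=
  Submodule.mem_sup_left (tmul_mem_range_lTensor a hb)

lemma tmul_mem_hopfSum_left {N : Submodule R A} {a : A} (ha : a ∈ N) (b : A) :
    a ⊗ₜ b ∈ hopfSum N :=
  Submodule.mem_sup_right (tmul_mem_range_rTensor ha b)

lemma mul_mem_hopfSum {N : Submodule R A} (hN : ∀ a, ∀ x ∈ N, a * x ∈ N) (z : A ⊗[R] A)
    {x : A ⊗[R] A} (hx : x ∈ hopfSum N) : z * x ∈ hopfSum N := by
  induction z with
  | zero => simp
  | tmul c d =>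
    refine (hopfSum_induction (P := (hopfSum N).comap (LinearMap.mulLeft R (c ⊗ₜ d)))
      (fun a b hb => ?_) (fun a ha b => ?_)) hx
    · simpa using tmul_mem_hopfSum_right (c * a) (hN d b hb)
    · simpa using tmul_mem_hopfSum_left (hN c a ha) (d * b)
  | add z z' hz hz' => simpa only [add_mul] using add_mem hz hz'

lemma mem_hopfSum_mul {N : Submodule R A} (hN : ∀ a, ∀ x ∈ N, x * a ∈ N) (z : A ⊗[R] A)
    {x : A ⊗[R] A} (hx : x ∈ hopfSum N) : x * z ∈ hopfSum N := by
  induction z with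
  | zero => simp
  | tmul c d =>
    refine (hopfSum_induction (P := (hopfSum N).comap (LinearMap.mulRight R (c ⊗ₜ d)))
      (fun a b hb => ?_) (fun a ha b => ?_)) hx
    · simpa using tmul_mem_hopfSum_right (a * c) (hN d b hb)
    · simpa using tmul_mem_hopfSum_left (hN c a ha) (b * d)
  | add z z' hz hz' => simpa only [mul_add] using add_mem hz hz'

end Contraction

section Quotient

variable {R A Q : Type*} [CommRing R] [Ring A] [Algebra R A] [Ring Q] [Algebra R Q]

/-- The Hopf algebra structure induced on the target of a surjective algebra homomorphism that is
compatible with candidate structure maps on the target. -/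
def HopfAlgStruct.ofSurjective (H : HopfAlgStruct R A) (q : A →ₐ[R] Q)
    (hq : Function.Surjective q) (Δ : Q →ₐ[R] Q ⊗[R] Q) (ε : Q →ₐ[R] R) (S : Q →ₗ[R] Q)
    (hΔ : ∀ x, Δ (q x) = TensorProduct.map q.toLinearMap q.toLinearMap (H.comul x))
    (hε : ∀ x, ε (q x) = H.counit x) (hS : ∀ x, S (q x) = q (H.antipode x)) :
    HopfAlgStruct R Q where
  comul := Δ
  counit := ε
  antipode := S
  antipode_one := by rw [← map_one q, hS, H.antipode_one]
  antipode_mul x y := by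
    obtain ⟨x, rfl⟩ := hq x
    obtain ⟨y, rfl⟩ := hq y
    rw [← map_mul, hS, hS, hS, H.antipode_mul, map_mul]
  coassoc x := by
    obtain ⟨x, rfl⟩ := hq x
    have hl : ∀ y : A ⊗[R] A, TensorProduct.assoc R Q Q Q
        (Algebra.TensorProduct.map Δ (AlgHom.id R Q)
          (TensorProduct.map q.toLinearMap q.toLinearMap y)) =
        TensorProduct.map q.toLinearMap (TensorProduct.map q.toLinearMap q.toLinearMap)
          (TensorProduct.assoc R A A A
            (Algebra.TensorProduct.map H.comul (AlgHom.id R A) y)) := fun y => by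
      rw [TensorProduct.map_map_assoc]
      congr 1
      induction y with
      | zero => simp
      | tmul a b => simp [hΔ]
      | add x y hx hy => simp only [map_add, hx, hy]
    have hr : ∀ y : A ⊗[R] A, Algebra.TensorProduct.map (AlgHom.id R Q) Δ
          (TensorProduct.map q.toLinearMap q.toLinearMap y) =
        TensorProduct.map q.toLinearMap (TensorProduct.map q.toLinearMap q.toLinearMap)
          (Algebra.TensorProduct.map (AlgHom.id R A) H.comul y) := fun y => by
      induction y with
      | zero => simp
      | tmul a b => simp [hΔ]
      | add x y hx hy => simp only [map_add, hx, hy]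
    rw [hΔ, hl, hr, H.coassoc]
  counit_comul x := by
    obtain ⟨x, rfl⟩ := hq x
    have h : ∀ y : A ⊗[R] A, TensorProduct.lid R Q (LinearMap.rTensor Q ε.toLinearMap
        (TensorProduct.map q.toLinearMap q.toLinearMap y)) =
        q (TensorProduct.lid R A (LinearMap.rTensor A H.counit.toLinearMap y)) := fun y => by
      induction y with
      | zero => simp
      | tmul a b => simp [hε]
      | add x y hx hy => simp only [map_add, hx, hy]
    rw [hΔ, h, H.counit_comul]
  comul_counit x := by
    obtain ⟨x, rfl⟩ := hq x
    have h : ∀ y : A ⊗[R] A, TensorProduct.rid R Q (LinearMap.lTensor Q ε.toLinearMap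
        (TensorProduct.map q.toLinearMap q.toLinearMap y)) =
        q (TensorProduct.rid R A (LinearMap.lTensor A H.counit.toLinearMap y)) := fun y => by
      induction y with
      | zero => simp
      | tmul a b => simp [hε]
      | add x y hx hy => simp only [map_add, hx, hy]
    rw [hΔ, h, H.comul_counit]
  mul_antipode_rTensor_comul x := by
    obtain ⟨x, rfl⟩ := hq x
    have h : ∀ y : A ⊗[R] A, LinearMap.mul' R Q (LinearMap.rTensor Q S
        (TensorProduct.map q.toLinearMap q.toLinearMap y)) =
        q (LinearMap.mul' R A (LinearMap.rTensor A H.antipode y)) := fun y => by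
      induction y with
      | zero => simp
      | tmul a b => simp [hS]
      | add x y hx hy => simp only [map_add, hx, hy]
    rw [hΔ, h, H.mul_antipode_rTensor_comul, hε, AlgHom.commutes]
  mul_antipode_lTensor_comul x := by
    obtain ⟨x, rfl⟩ := hq x
    have h : ∀ y : A ⊗[R] A, LinearMap.mul' R Q (LinearMap.lTensor Q S
        (TensorProduct.map q.toLinearMap q.toLinearMap y)) =
        q (LinearMap.mul' R A (LinearMap.lTensor A H.antipode y)) := fun y => by
      induction y with
      | zero => simp
      | tmul a b => simp [hS]
      | add x y hx hy => simp only [map_add, hx, hy]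
    rw [hΔ, h, H.mul_antipode_lTensor_comul, hε, AlgHom.commutes]

end Quotient

section HopfIdeal

variable {R A G : Type*} [CommRing R] [Ring A] [Algebra R A] [Group G]

/-- An element `a` with `Δ(a) = a ⊗ a`. -/
def HopfAlgStruct.IsGroupLike (Hst : HopfAlgStruct R A) (a : A) : Prop :=
  Hst.comul a = a ⊗ₜ[R] a

/-- An element `d` with `Δ(d) = d ⊗ 1 + g ⊗ d`. -/
def HopfAlgStruct.IsSkewPrimitive (Hst : HopfAlgStruct R A) (g d : A) : Prop :=
  Hst.comul d = d ⊗ₜ[R] 1 + g ⊗ₜ[R] d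

variable {Hst : HopfAlgStruct R A}

lemma HopfAlgStruct.isGroupLike_one : Hst.IsGroupLike 1 := by
  rw [IsGroupLike, map_one, Algebra.TensorProduct.one_def]

lemma HopfAlgStruct.IsGroupLike.mul {a b : A} (ha : Hst.IsGroupLike a) (hb : Hst.IsGroupLike b) :
    Hst.IsGroupLike (a * b) := by
  rw [IsGroupLike] at *
  rw [map_mul, ha, hb, Algebra.TensorProduct.tmul_mul_tmul]

lemma HopfAlgStruct.IsSkewPrimitive.conj {s g d : A} (hd : Hst.IsSkewPrimitive g d)
    (hs : Hst.IsGroupLike s) (hss : s * s = 1) :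
    Hst.IsSkewPrimitive (s * g * s) (s * d * s) := by
  rw [IsGroupLike, IsSkewPrimitive] at *
  rw [map_mul, map_mul, hd, hs]
  simp only [mul_add, add_mul, Algebra.TensorProduct.tmul_mul_tmul, mul_one, hss]

lemma HopfAlgStruct.comul_mem_of_mem_adjoin {X : Set A}
    (hX : ∀ d ∈ X, ∃ g, Hst.IsSkewPrimitive g d) {x : A} (hx : x ∈ Algebra.adjoin R X) :
    Hst.comul x ∈ LinearMap.range
      ((Subalgebra.toSubmodule (Algebra.adjoin R X)).subtype.lTensor A) := by
  have key : Algebra.adjoin R X ≤ (Algebra.TensorProduct.map (AlgHom.id R A)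
      (Algebra.adjoin R X).val).range.comap Hst.comul := by
    refine Algebra.adjoin_le fun d hd => ?_
    obtain ⟨g, h⟩ := hX d hd
    refine ⟨d ⊗ₜ 1 + g ⊗ₜ ⟨d, Algebra.subset_adjoin hd⟩, ?_⟩
    refine Eq.trans ?_ h.symm
    simp
  obtain ⟨y, hy⟩ := key hx
  exact ⟨y, hy⟩

variable {π : G →* Aˣ} {D : Subalgebra R A}

/-- Conjugation by `π(w)`. -/
def conjMap (R : Type*) {A G : Type*} [CommRing R] [Ring A] [Algebra R A] [Group G]
    (π : G →* Aˣ) (w : G) : A →ₗ[R] A :=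
  LinearMap.mulRight R (((π w)⁻¹ : Aˣ) : A) ∘ₗ LinearMap.mulLeft R (π w : A)

lemma conjMap_apply (w : G) (x : A) :
    conjMap R π w x = (π w : A) * x * (((π w)⁻¹ : Aˣ) : A) := rfl

lemma conjMap_inv_comp (w : G) : conjMap R π w⁻¹ ∘ₗ conjMap R π w = LinearMap.id := by
  ext x
  simp [conjMap_apply, mul_assoc]

lemma HopfAlgStruct.comul_conjMap (hπ : ∀ w, Hst.IsGroupLike (π w : A)) (w : G) (x : A) :
    Hst.comul (conjMap R π w x) =
      TensorProduct.map (conjMap R π w) (conjMap R π w) (Hst.comul x) := by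
  have h : ∀ y : A ⊗[R] A,
      ((π w : A) ⊗ₜ[R] (π w : A)) * y * ((π w⁻¹ : A) ⊗ₜ[R] (π w⁻¹ : A)) =
        TensorProduct.map (conjMap R π w) (conjMap R π w) y := fun y => by
    induction y with
    | zero => simp
    | tmul a b => simp [conjMap_apply]
    | add x y hx hy => simp only [map_add, mul_add, add_mul, hx, hy]
  rw [← h, conjMap_apply, ← map_inv, map_mul, map_mul, hπ w, hπ w⁻¹]

/-- The intersection of all conjugates of the subalgebra `D` under `π`. -/
def conjCore (π : G →* Aˣ) (D : Subalgebra R A) : Submodule R A :=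
  ⨅ w : G, (Subalgebra.toSubmodule D).comap (conjMap R π w)

lemma mem_conjCore {x : A} :
    x ∈ conjCore π D ↔ ∀ w, (π w : A) * x * (((π w)⁻¹ : Aˣ) : A) ∈ D :=
  Submodule.mem_iInf _

lemma one_mem_conjCore : (1 : A) ∈ conjCore π D :=
  mem_conjCore.2 fun w => by simp

/-- The two-sided ideal generated by the elements of `conjCore π D` with counit zero. -/
def conjCoreIdeal (π : G →* Aˣ) (D : Subalgebra R A) (ε : A →ₐ[R] R) : Submodule R A :=
  Submodule.span R {y | ∃ a k b : A,
    (∀ w, (π w : A) * k * (((π w)⁻¹ : Aˣ) : A) ∈ D) ∧ ε k = 0 ∧ y = a * k * b}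

variable {ε : A →ₐ[R] R}

lemma mem_conjCoreIdeal {k : A} (hk : k ∈ conjCore π D) (h : ε k = 0) :
    k ∈ conjCoreIdeal π D ε :=
  Submodule.subset_span ⟨1, k, 1, mem_conjCore.1 hk, h, by simp⟩

lemma conjCoreIdeal_le {P : Submodule R A}
    (h : ∀ a b, ∀ k ∈ conjCore π D, ε k = 0 → a * k * b ∈ P) : conjCoreIdeal π D ε ≤ P := by
  refine Submodule.span_le.2 ?_
  rintro _ ⟨a, k, b, hk, hε, rfl⟩
  exact h a b k (mem_conjCore.2 hk) hε

lemma mul_mem_conjCoreIdeal (a : A) {x : A} (hx : x ∈ conjCoreIdeal π D ε) :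
    a * x ∈ conjCoreIdeal π D ε := by
  refine (conjCoreIdeal_le (P := (conjCoreIdeal π D ε).comap (LinearMap.mulLeft R a))
    fun c d k hk hε => Submodule.subset_span ?_) hx
  exact ⟨a * c, k, d, mem_conjCore.1 hk, hε, by simp [mul_assoc]⟩

lemma mem_conjCoreIdeal_mul (a : A) {x : A} (hx : x ∈ conjCoreIdeal π D ε) :
    x * a ∈ conjCoreIdeal π D ε := by
  refine (conjCoreIdeal_le (P := (conjCoreIdeal π D ε).comap (LinearMap.mulRight R a))
    fun c d k hk hε => Submodule.subset_span ?_) hx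
  exact ⟨c, k, d * a, mem_conjCore.1 hk, hε, by simp [mul_assoc]⟩

lemma counit_eq_zero_of_mem_conjCoreIdeal {x : A} (hx : x ∈ conjCoreIdeal π D ε) : ε x = 0 := by
  refine (conjCoreIdeal_le (P := LinearMap.ker ε.toLinearMap) fun a b k _ hε => ?_) hx
  simp [hε]

/-- The conditions under which `conjCoreIdeal` is a Hopf ideal: `π` takes group-like values and
`D` is a left coideal. -/
structure HopfAlgStruct.IsCompatible (Hst : HopfAlgStruct R A) (π : G →* Aˣ)
    (D : Subalgebra R A) : Prop where
  isGroupLike : ∀ w, Hst.IsGroupLike (π w : A)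
  comul_mem : ∀ x ∈ D,
    Hst.comul x ∈ LinearMap.range ((Subalgebra.toSubmodule D).subtype.lTensor A)

namespace HopfAlgStruct.IsCompatible

lemma comul_mem_of_mem_conjCore [Module.Free R A] (H : Hst.IsCompatible π D) {x : A}
    (hx : x ∈ conjCore π D) :
    Hst.comul x ∈ LinearMap.range ((conjCore π D).subtype.lTensor A) := by
  refine mem_range_lTensor_of_contractLeft fun φ => ?_
  refine (Submodule.mem_iInf _).2 fun w => ?_
  have e : conjMap R π w (contractLeft φ (Hst.comul x)) =
      contractLeft (φ ∘ₗ conjMap R π w⁻¹) (Hst.comul (conjMap R π w x)) := by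
    rw [comul_conjMap H.isGroupLike, contractLeft_map, LinearMap.comp_assoc, conjMap_inv_comp,
      LinearMap.comp_id]
  rw [Submodule.mem_comap, e]
  exact contractLeft_mem _ (H.comul_mem _ (mem_conjCore.1 hx w))

lemma comul_sub_tmul_one_mem [Module.Free R A] (H : Hst.IsCompatible π D) {k : A}
    (hk : k ∈ conjCore π D) :
    Hst.comul k - k ⊗ₜ[R] 1 ∈
      LinearMap.range ((conjCoreIdeal π D Hst.counit).subtype.lTensor A) := by
  have hsub : ∀ y ∈ LinearMap.range ((conjCore π D).subtype.lTensor A),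
      y - TensorProduct.rid R A (LinearMap.lTensor A Hst.counit.toLinearMap y) ⊗ₜ[R] 1 ∈
        LinearMap.range ((conjCoreIdeal π D Hst.counit).subtype.lTensor A) := by
    rintro _ ⟨y, rfl⟩
    induction y with
    | zero => simp
    | tmul a b =>
      have hb : (b : A) - Hst.counit b • 1 ∈ conjCoreIdeal π D Hst.counit :=
        mem_conjCoreIdeal (sub_mem b.2 (Submodule.smul_mem _ _ one_mem_conjCore)) (by simp)
      have := tmul_mem_range_lTensor a hb
      rw [TensorProduct.tmul_sub, TensorProduct.tmul_smul, TensorProduct.smul_tmul'] at this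
      simpa using this
    | add x y hx hy =>
      simp only [map_add, TensorProduct.add_tmul, add_sub_add_comm]
      exact add_mem hx hy
  have := hsub _ (H.comul_mem_of_mem_conjCore hk)
  rwa [Hst.comul_counit] at this

lemma comul_mem_hopfSum [Module.Free R A] (H : Hst.IsCompatible π D) {x : A}
    (hx : x ∈ conjCoreIdeal π D Hst.counit) :
    Hst.comul x ∈ hopfSum (conjCoreIdeal π D Hst.counit) := by
  refine (conjCoreIdeal_le
    (P := (hopfSum (conjCoreIdeal π D Hst.counit)).comap Hst.comul.toLinearMap)
    fun a b k hk hε => ?_) hx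
  have hk' : Hst.comul k ∈ hopfSum (conjCoreIdeal π D Hst.counit) := by
    rw [← sub_add_cancel (Hst.comul k) (k ⊗ₜ 1)]
    exact add_mem (Submodule.mem_sup_left (H.comul_sub_tmul_one_mem hk))
      (tmul_mem_hopfSum_left (mem_conjCoreIdeal hk hε) 1)
  rw [Submodule.mem_comap, AlgHom.toLinearMap_apply, map_mul, map_mul]
  exact mem_hopfSum_mul (fun a _ h => mem_conjCoreIdeal_mul a h) _
    (mul_mem_hopfSum (fun a _ h => mul_mem_conjCoreIdeal a h) _ hk')

lemma antipode_mem [Module.Free R A] (H : Hst.IsCompatible π D) {x : A}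
    (hx : x ∈ conjCoreIdeal π D Hst.counit) :
    Hst.antipode x ∈ conjCoreIdeal π D Hst.counit := by
  refine (conjCoreIdeal_le (P := (conjCoreIdeal π D Hst.counit).comap Hst.antipode)
    fun a b k hk hε => ?_) hx
  rw [Submodule.mem_comap, Hst.antipode_mul, Hst.antipode_mul]
  refine mul_mem_conjCoreIdeal _ (mem_conjCoreIdeal_mul _ ?_)
  have hmul : ∀ y ∈ LinearMap.range ((conjCoreIdeal π D Hst.counit).subtype.lTensor A),
      LinearMap.mul' R A (LinearMap.rTensor A Hst.antipode y) ∈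
        conjCoreIdeal π D Hst.counit := by
    rintro _ ⟨y, rfl⟩
    induction y with
    | zero => simp
    | tmul a b => simpa using mul_mem_conjCoreIdeal (Hst.antipode a) b.2
    | add x y hx hy => simpa only [map_add] using add_mem hx hy
  have := hmul _ (H.comul_sub_tmul_one_mem hk)
  rw [map_sub, map_sub, Hst.mul_antipode_rTensor_comul, hε] at this
  simpa using this

end HopfAlgStruct.IsCompatible

/-- The antipode of a Hopf algebra structure followed by an algebra homomorphism `q`, as an algebra
homomorphism to the opposite algebra. -/
noncomputable def HopfAlgStruct.antipodeOp {Q : Type*} [Ring Q] [Algebra R Q]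
    (Hst : HopfAlgStruct R A) (q : A →ₐ[R] Q) : A →ₐ[R] Qᵐᵒᵖ :=
  AlgHom.ofLinearMap
    ((MulOpposite.opLinearEquiv R).toLinearMap ∘ₗ q.toLinearMap ∘ₗ Hst.antipode)
    (by simp [Hst.antipode_one]) (fun x y => by simp [Hst.antipode_mul])

lemma HopfAlgStruct.antipodeOp_apply {Q : Type*} [Ring Q] [Algebra R Q]
    (Hst : HopfAlgStruct R A) (q : A →ₐ[R] Q) (x : A) :
    Hst.antipodeOp q x = MulOpposite.op (q (Hst.antipode x)) := rfl

/-- The relation equating the elements of `conjCore π D` with counit zero to zero. -/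
def conjCoreRel (π : G →* Aˣ) (D : Subalgebra R A) (ε : A →ₐ[R] R) : A → A → Prop :=
  fun x y => (∀ w, (π w : A) * x * (((π w)⁻¹ : Aˣ) : A) ∈ D) ∧ ε x = 0 ∧ y = 0

lemma mem_of_conjCoreRel {x y : A} (h : conjCoreRel π D ε x y) :
    x ∈ conjCoreIdeal π D ε ∧ y = 0 :=
  ⟨mem_conjCoreIdeal (mem_conjCore.2 h.1) h.2.1, h.2.2⟩

lemma mkAlgHom_conjCoreRel_eq_zero {x : A} (hx : x ∈ conjCoreIdeal π D ε) :
    RingQuot.mkAlgHom R (conjCoreRel π D ε) x = 0 := by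
  refine (conjCoreIdeal_le
    (P := LinearMap.ker (RingQuot.mkAlgHom R (conjCoreRel π D ε)).toLinearMap)
    fun a b k hk hε => ?_) hx
  have h := RingQuot.mkAlgHom_rel R
    (show conjCoreRel π D ε k 0 from ⟨mem_conjCore.1 hk, hε, rfl⟩)
  rw [map_zero] at h
  simp [h]

lemma map_eq_zero_of_mem_hopfSum {Q : Type*} [Ring Q] [Algebra R Q] {q : A →ₐ[R] Q}
    {N : Submodule R A} (hq : ∀ x ∈ N, q x = 0) {x : A ⊗[R] A} (hx : x ∈ hopfSum N) :
    TensorProduct.map q.toLinearMap q.toLinearMap x = 0 := by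
  refine (hopfSum_induction
    (P := LinearMap.ker (TensorProduct.map q.toLinearMap q.toLinearMap))
    (fun a b hb => ?_) (fun a ha b => ?_)) hx
  · simp [hq b hb]
  · simp [hq a ha]

lemma HopfAlgStruct.IsCompatible.exists_quotient [Module.Free R A] (H : Hst.IsCompatible π D) :
    ∃ Hq : HopfAlgStruct R (RingQuot (conjCoreRel π D Hst.counit)),
      (∀ x, Hq.comul (RingQuot.mkAlgHom R (conjCoreRel π D Hst.counit) x) =
        (TensorProduct.map (RingQuot.mkAlgHom R (conjCoreRel π D Hst.counit)).toLinearMap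
          (RingQuot.mkAlgHom R (conjCoreRel π D Hst.counit)).toLinearMap) (Hst.comul x)) ∧
      (∀ x, Hq.counit (RingQuot.mkAlgHom R (conjCoreRel π D Hst.counit) x) = Hst.counit x) ∧
      (∀ x, Hq.antipode (RingQuot.mkAlgHom R (conjCoreRel π D Hst.counit) x) =
        RingQuot.mkAlgHom R (conjCoreRel π D Hst.counit) (Hst.antipode x)) := by
  let q := RingQuot.mkAlgHom R (conjCoreRel π D Hst.counit)
  have hq : ∀ x ∈ conjCoreIdeal π D Hst.counit, q x = 0 := fun x =>
    mkAlgHom_conjCoreRel_eq_zero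
  have hΔ : ∀ ⦃x y : A⦄, conjCoreRel π D Hst.counit x y →
      ((Algebra.TensorProduct.map q q).comp Hst.comul) x =
        ((Algebra.TensorProduct.map q q).comp Hst.comul) y := fun x y h => by
    obtain ⟨hx, rfl⟩ := mem_of_conjCoreRel h
    rw [map_zero]
    exact map_eq_zero_of_mem_hopfSum hq (H.comul_mem_hopfSum hx)
  have hε : ∀ ⦃x y : A⦄, conjCoreRel π D Hst.counit x y →
      Hst.counit x = Hst.counit y := fun x y h => by
    obtain ⟨hx, rfl⟩ := mem_of_conjCoreRel h
    rw [map_zero, counit_eq_zero_of_mem_conjCoreIdeal hx]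
  have hS : ∀ ⦃x y : A⦄, conjCoreRel π D Hst.counit x y →
      Hst.antipodeOp q x = Hst.antipodeOp q y := fun x y h => by
    obtain ⟨hx, rfl⟩ := mem_of_conjCoreRel h
    rw [map_zero, Hst.antipodeOp_apply, hq _ (H.antipode_mem hx), MulOpposite.op_zero]
  let S := (MulOpposite.opLinearEquiv R).symm.toLinearMap ∘ₗ
    (RingQuot.liftAlgHom R ⟨Hst.antipodeOp q, hS⟩).toLinearMap
  have h1 := RingQuot.liftAlgHom_mkAlgHom_apply R _ hΔ
  have h2 := RingQuot.liftAlgHom_mkAlgHom_apply R _ hε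
  have h3 : ∀ x, S (q x) = q (Hst.antipode x) := fun x => by
    simp [S, q, Hst.antipodeOp_apply]
  exact ⟨Hst.ofSurjective q (RingQuot.mkAlgHom_surjective R _) (RingQuot.liftAlgHom R ⟨_, hΔ⟩)
    (RingQuot.liftAlgHom R ⟨_, hε⟩) S h1 h2 h3, h1, h2, h3⟩

end HopfIdeal

section Compatible

variable {B : Type*} {M : CoxeterMatrix B} {π : M.Group →* (HW M)ˣ} {Dfam : Refl M → HW M}
  {Hst : HopfAlgStruct ℤ (HW M)}

lemma IsReflFamily.isGroupLike_coe (H : IsReflFamily π Dfam)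
    (hs : ∀ i : B, Hst.IsGroupLike (hs M i)) (w : M.Group) : Hst.IsGroupLike (π w : HW M) := by
  induction w using M.toCoxeterSystem.simple_induction_left with
  | one =>
    rw [map_one]
    exact HopfAlgStruct.isGroupLike_one
  | mul_simple_left w i ih =>
    rw [map_mul, Units.val_mul, H.coe_simple]
    exact (hs i).mul ih

lemma IsReflFamily.isSkewPrimitive_Dfam (H : IsReflFamily π Dfam)
    (hs : ∀ i : B, Hst.IsGroupLike (hs M i))
    (hD : ∀ i : B, Hst.IsSkewPrimitive (HeckeHopfCox.hs M i) (hD M i)) (t : Refl M) :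
    Hst.IsSkewPrimitive (π t : HW M) (Dfam t) := by
  induction t using refl_induction with
  | simple i h =>
    rw [H.simple, H.coe_simple]
    exact hD i
  | conj i t hti h ih =>
    rw [← H.conj i t hti h, map_mul, map_mul, Units.val_mul, Units.val_mul, H.coe_simple]
    exact ih.conj (hs i) (hs_mul_self i)

lemma IsReflFamily.isCompatible (H : IsReflFamily π Dfam)
    (hs : ∀ i : B, Hst.IsGroupLike (hs M i))
    (hD : ∀ i : B, Hst.IsSkewPrimitive (HeckeHopfCox.hs M i) (hD M i)) :
    Hst.IsCompatible π (Algebra.adjoin ℤ (Set.range Dfam)) where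
  isGroupLike := H.isGroupLike_coe hs
  comul_mem x hx := by
    refine HopfAlgStruct.comul_mem_of_mem_adjoin ?_ hx
    rintro _ ⟨t, rfl⟩
    exact ⟨_, H.isSkewPrimitive_Dfam hs hD t⟩

end Compatible

/-- For every Coxeter group `W`, the ideal `J(W)` of `Ĥ(W)` generated by
`K(W) ∩ ker ε` is a Hopf ideal: `Δ(J) ⊆ Ĥ(W) ⊗ J + J ⊗ Ĥ(W)`, `ε(J) = 0`, `S(J) ⊆ J`;
consequently the quotient `H̲(W) = Ĥ(W)/J(W)` inherits a Hopf algebra structure over `ℤ`. -/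
theorem J_is_hopf_ideal {B : Type*} (M : CoxeterMatrix B)
    (π : M.Group →* (HW M)ˣ)
    (hπ : ∀ i : B, ((π (M.toCoxeterSystem.simple i) : (HW M)ˣ) : HW M) = hs M i)
    (Dfam : Refl M → HW M)
    (hD1 : ∀ (i : B) (h : M.toCoxeterSystem.IsReflection (M.toCoxeterSystem.simple i)),
      Dfam ⟨M.toCoxeterSystem.simple i, h⟩ = hD M i)
    (hD2 : ∀ (i : B) (t : Refl M),
      (t : M.Group) ≠ M.toCoxeterSystem.simple i →
      ∀ h : M.toCoxeterSystem.IsReflection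
          (M.toCoxeterSystem.simple i * (t : M.Group) * M.toCoxeterSystem.simple i),
        hs M i * Dfam t * hs M i =
          Dfam ⟨M.toCoxeterSystem.simple i * (t : M.Group) * M.toCoxeterSystem.simple i, h⟩)
    (Hst : HopfAlgStruct ℤ (HW M))
    (hΔs : ∀ i : B, Hst.comul (hs M i) = hs M i ⊗ₜ[ℤ] hs M i)
    (hΔD : ∀ i : B, Hst.comul (hD M i) = hD M i ⊗ₜ[ℤ] 1 + hs M i ⊗ₜ[ℤ] hD M i)
    (hεs : ∀ i : B, Hst.counit (hs M i) = 1)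
    (hεD : ∀ i : B, Hst.counit (hD M i) = 0)
    (hSs : ∀ i : B, Hst.antipode (hs M i) = hs M i)
    (hSD : ∀ i : B, Hst.antipode (hD M i) = -(hs M i * hD M i)) :
    (∀ x ∈ JW M π Dfam Hst.counit,
      Hst.comul x ∈
        LinearMap.range (LinearMap.lTensor (HW M) (JW M π Dfam Hst.counit).subtype) ⊔
          LinearMap.range (LinearMap.rTensor (HW M) (JW M π Dfam Hst.counit).subtype)) ∧
    (∀ x ∈ JW M π Dfam Hst.counit, Hst.counit x = 0) ∧
    (∀ x ∈ JW M π Dfam Hst.counit, Hst.antipode x ∈ JW M π Dfam Hst.counit) ∧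
    (∃ Hq : HopfAlgStruct ℤ (RingQuot (lowRel M π Dfam Hst.counit)),
      (∀ x : HW M,
        Hq.comul (RingQuot.mkAlgHom ℤ (lowRel M π Dfam Hst.counit) x) =
          (TensorProduct.map (RingQuot.mkAlgHom ℤ (lowRel M π Dfam Hst.counit)).toLinearMap
            (RingQuot.mkAlgHom ℤ (lowRel M π Dfam Hst.counit)).toLinearMap) (Hst.comul x)) ∧
      (∀ x : HW M,
        Hq.counit (RingQuot.mkAlgHom ℤ (lowRel M π Dfam Hst.counit) x) = Hst.counit x) ∧
      (∀ x : HW M,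
        Hq.antipode (RingQuot.mkAlgHom ℤ (lowRel M π Dfam Hst.counit) x) =
          RingQuot.mkAlgHom ℤ (lowRel M π Dfam Hst.counit) (Hst.antipode x))) := by
  have hR : IsReflFamily π Dfam := ⟨hπ, hD1, hD2⟩
  have H : Hst.IsCompatible π (Algebra.adjoin ℤ (Set.range Dfam)) := hR.isCompatible hΔs hΔD
  have hfree : @Module.Free ℤ (HW M) _ _ Algebra.toModule := hR.free
  exact ⟨fun x hx => H.comul_mem_hopfSum hx,
    fun x hx => counit_eq_zero_of_mem_conjCoreIdeal hx,
    fun x hx => H.antipode_mem hx, H.exists_quotient⟩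

end HeckeHopfCox
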